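/- arXiv:1010.3126 — 3 statements merged into one kernel-verified Lean document; each statement's English description precedes it below -/
import Mathlib

section
/- Let a, b, F₁, F₂ : ℝ² → ℝ be smooth. Then the linearized factorization equation F₁·(∂ₓu + b·u) + ∂ₓ(F₂·u) + a·(F₂·u) = 0 holds for every smooth u : ℝ² → ℝ if and only if F₂ = −F₁ and ∂ₓF₁ = (b − a)·F₁ on ℝ². -/
/-- Partial derivative in the first (`x`) variable of a function on the plane. -/
noncomputable def Dx (u : ℝ → ℝ → ℝ) : ℝ → ℝ → ℝ := fun x y => deriv (fun s => u s y) x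

/-- Partial derivative in the second (`y`) variable of a function on the plane. -/
noncomputable def Dy (u : ℝ → ℝ → ℝ) : ℝ → ℝ → ℝ := fun x y => deriv (fun t => u x t) y

/-- A function on the plane is smooth if it is infinitely differentiable as a function
of the pair of variables. -/
def Smooth2 (u : ℝ → ℝ → ℝ) : Prop := ContDiff ℝ (⊤ : ℕ∞) (fun p : ℝ × ℝ => u p.1 p.2)

/-- The first-order operator `Dₓ + p`, sending `u` to `∂ₓu + p·u`. -/
noncomputable def opX (p u : ℝ → ℝ → ℝ) : ℝ → ℝ → ℝ := fun x y => Dx u x y + p x y * u x y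

/-- The first-order operator `D_y + q`, sending `u` to `∂_yu + q·u`. -/
noncomputable def opY (q u : ℝ → ℝ → ℝ) : ℝ → ℝ → ℝ := fun x y => Dy u x y + q x y * u x y

theorem Smooth2.differentiableAt_fst {u : ℝ → ℝ → ℝ} (hu : Smooth2 u) (x y : ℝ) :
    DifferentiableAt ℝ (fun s => u s y) x := by
  have h : Differentiable ℝ (fun p : ℝ × ℝ => u p.1 p.2) :=
    ContDiff.differentiable hu (by simp)
  have h_pair : Differentiable ℝ (fun s : ℝ => (s, y)) := by fun_prop
  exact (h.comp h_pair) x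

theorem Dx_mul {u v : ℝ → ℝ → ℝ} (hu : Smooth2 u) (hv : Smooth2 v) (x y : ℝ) :
    Dx (fun x y => u x y * v x y) x y = Dx u x y * v x y + u x y * Dx v x y :=
  deriv_fun_mul (hu.differentiableAt_fst x y) (hv.differentiableAt_fst x y)

theorem Dx_neg (u : ℝ → ℝ → ℝ) (x y : ℝ) : Dx (fun x y => -u x y) x y = -Dx u x y := by
  simp [Dx]

theorem stmt4 (a b F₁ F₂ : ℝ → ℝ → ℝ)
    (ha : Smooth2 a) (hb : Smooth2 b) (hF₁ : Smooth2 F₁) (hF₂ : Smooth2 F₂) :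
    (∀ u : ℝ → ℝ → ℝ, Smooth2 u → ∀ x y : ℝ,
        F₁ x y * (Dx u x y + b x y * u x y)
          + Dx (fun x y => F₂ x y * u x y) x y + a x y * (F₂ x y * u x y) = 0)
      ↔ ((∀ x y : ℝ, F₂ x y = -F₁ x y) ∧
         (∀ x y : ℝ, Dx F₁ x y = (b x y - a x y) * F₁ x y)) := by
  constructor
  · intro h
    have h_one : Smooth2 (fun _ _ => 1) := contDiff_const
    have h_fst : Smooth2 (fun x _ => x) := contDiff_fst
    have h_sum : ∀ x y : ℝ, F₂ x y = -F₁ x y := by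
      intro x y
      have e₁ := h _ h_one x y
      have e₂ := h _ h_fst x y
      rw [Dx_mul hF₂ h_one] at e₁
      rw [Dx_mul hF₂ h_fst] at e₂
      simp only [Dx, deriv_const, deriv_id''] at e₁ e₂
      linear_combination e₂ - x * e₁
    refine ⟨h_sum, fun x y => ?_⟩
    have e₁ := h _ h_one x y
    obtain rfl : F₂ = fun x y => -F₁ x y := funext₂ h_sum
    rw [Dx_mul hF₂ h_one, Dx_neg] at e₁
    have h_const : Dx (fun _ _ => 1) x y = 0 := deriv_const x 1
    rw [h_const] at e₁
    linear_combination -e₁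
  · rintro ⟨h_sum, h_deriv⟩ u hu x y
    obtain rfl : F₂ = fun x y => -F₁ x y := funext₂ h_sum
    rw [Dx_mul hF₂ hu, Dx_neg, h_deriv]
    ring
end

section
/- Let r, b, c, r₁, a₁₀, a₀₁, a₀₀ : ℝ² → ℝ be smooth, and consider the operators L₂ : u ↦ ∂ₓ∂_yu + b·∂_yu + c·u (type (XY) with zero coefficient at Dₓ), L₁ : v ↦ ∂ₓv + r·v, F₁ : u ↦ r₁·u, F₂ : u ↦ a₁₀·∂ₓu + a₀₁·∂_yu + a₀₀·u. Then the linearized factorization equation F₁(L₂u) + L₁(F₂u) = 0 holds for every smooth u : ℝ² → ℝ if and only if a₁₀ = 0, a₀₀ = 0, r₁ = −a₀₁, ∂ₓa₀₁ = (b − r)·a₀₁, and a₀₁·c = 0 on ℝ². In particular a nontrivial solution exists only where c = 0, and every solution is determined by a single function: a₀₁ = f₁(y)·e^{∫(b−r)dx}. -/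
theorem Smooth2.hasDerivAt_dx {u : ℝ → ℝ → ℝ} (hu : Smooth2 u) (x y : ℝ) :
    HasDerivAt (fun s => u s y) (Dx u x y) x := by
  have h : ContDiff ℝ (⊤ : ℕ∞) (fun s : ℝ => u s y) :=
    ContDiff.comp (g := fun p : ℝ × ℝ => u p.1 p.2) (f := fun s : ℝ => (s, y)) hu
      (contDiff_id.prodMk contDiff_const)
  exact (h.differentiable (by simp) x).hasDerivAt

theorem Smooth2.dx_eq_fderiv {u : ℝ → ℝ → ℝ} (hu : Smooth2 u) (x y : ℝ) :
    Dx u x y = fderiv ℝ (fun p : ℝ × ℝ => u p.1 p.2) (x, y) (1, 0) := by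
  have h := (ContDiff.differentiable hu (by simp) (x, y)).hasFDerivAt
  exact (h.comp_hasDerivAt x ((hasDerivAt_id x).prodMk (hasDerivAt_const x y))).deriv

theorem Smooth2.dy_eq_fderiv {u : ℝ → ℝ → ℝ} (hu : Smooth2 u) (x y : ℝ) :
    Dy u x y = fderiv ℝ (fun p : ℝ × ℝ => u p.1 p.2) (x, y) (0, 1) := by
  have h := (ContDiff.differentiable hu (by simp) (x, y)).hasFDerivAt
  exact (h.comp_hasDerivAt y ((hasDerivAt_const y x).prodMk (hasDerivAt_id y))).deriv

theorem Smooth2.dx {u : ℝ → ℝ → ℝ} (hu : Smooth2 u) : Smooth2 (Dx u) := by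
  unfold Smooth2
  simp only [hu.dx_eq_fderiv]
  exact (ContDiff.fderiv_right hu (by simp)).clm_apply contDiff_const

theorem Smooth2.dy {u : ℝ → ℝ → ℝ} (hu : Smooth2 u) : Smooth2 (Dy u) := by
  unfold Smooth2
  simp only [hu.dy_eq_fderiv]
  exact (ContDiff.fderiv_right hu (by simp)).clm_apply contDiff_const

/-- The composition of `Dₓ + r` with a first-order operator, in expanded form. -/
theorem opX_firstOrder {r p q w u : ℝ → ℝ → ℝ} (hp : Smooth2 p) (hq : Smooth2 q)
    (hw : Smooth2 w) (hu : Smooth2 u) (x y : ℝ) :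
    opX r (fun x y => p x y * Dx u x y + q x y * Dy u x y + w x y * u x y) x y =
      p x y * Dx (Dx u) x y + q x y * Dx (Dy u) x y
        + (Dx p x y + w x y + r x y * p x y) * Dx u x y
        + (Dx q x y + r x y * q x y) * Dy u x y
        + (Dx w x y + r x y * w x y) * u x y := by
  have h := ((((hp.hasDerivAt_dx x y).mul (hu.dx.hasDerivAt_dx x y)).add
    ((hq.hasDerivAt_dx x y).mul (hu.dy.hasDerivAt_dx x y))).add
    ((hw.hasDerivAt_dx x y).mul (hu.hasDerivAt_dx x y))).deriv
  change deriv _ x + _ = _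
  refine (congrArg (· + _) h).trans ?_
  ring

/-- A linear differential expression in `u`, `uₓ`, `u_y`, `uₓₓ`, `uₓ_y` that annihilates all
smooth functions at a point has zero coefficients. -/
theorem coeffs_eq_zero {x y k₂₀ k₁₁ k₁₀ k₀₁ k₀₀ : ℝ}
    (h : ∀ u : ℝ → ℝ → ℝ, Smooth2 u →
      k₂₀ * Dx (Dx u) x y + k₁₁ * Dx (Dy u) x y + k₁₀ * Dx u x y + k₀₁ * Dy u x y
        + k₀₀ * u x y = 0) :
    k₂₀ = 0 ∧ k₁₁ = 0 ∧ k₁₀ = 0 ∧ k₀₁ = 0 ∧ k₀₀ = 0 := by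
  have h₀₀ := h (fun _ _ => 1) (by unfold Smooth2; fun_prop)
  have h₁₀ := h (fun s _ => s - x) (by unfold Smooth2; fun_prop)
  have h₀₁ := h (fun _ t => t - y) (by unfold Smooth2; fun_prop)
  have h₂₀ := h (fun s _ => (s - x) * (s - x)) (by unfold Smooth2; fun_prop)
  have h₁₁ := h (fun s t => (s - x) * (t - y)) (by unfold Smooth2; fun_prop)
  have hsq : ∀ s : ℝ, deriv (fun s => (s - x) * (s - x)) s = 2 * (s - x) := fun s => by
    have := (((hasDerivAt_id s).sub_const x).mul ((hasDerivAt_id s).sub_const x)).deriv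
    refine this.trans ?_
    simp only [id]
    ring
  simp [Dx, Dy, hsq] at h₀₀ h₁₀ h₀₁ h₂₀ h₁₁
  exact ⟨h₂₀, h₁₁, h₁₀, h₀₁, h₀₀⟩


theorem stmt10 (r b c r₁ a₁₀ a₀₁ a₀₀ : ℝ → ℝ → ℝ)
    (hr : Smooth2 r) (hb : Smooth2 b) (hc : Smooth2 c) (hr₁ : Smooth2 r₁)
    (ha₁₀ : Smooth2 a₁₀) (ha₀₁ : Smooth2 a₀₁) (ha₀₀ : Smooth2 a₀₀) :
    (∀ u : ℝ → ℝ → ℝ, Smooth2 u → ∀ x y : ℝ,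
        r₁ x y * (Dx (Dy u) x y + b x y * Dy u x y + c x y * u x y)
          + opX r (fun x y => a₁₀ x y * Dx u x y + a₀₁ x y * Dy u x y
              + a₀₀ x y * u x y) x y = 0)
      ↔ ((∀ x y : ℝ, a₁₀ x y = 0) ∧ (∀ x y : ℝ, a₀₀ x y = 0) ∧
         (∀ x y : ℝ, r₁ x y = -a₀₁ x y) ∧
         (∀ x y : ℝ, Dx a₀₁ x y = (b x y - r x y) * a₀₁ x y) ∧
         (∀ x y : ℝ, a₀₁ x y * c x y = 0)) := by
  have expand : ∀ u : ℝ → ℝ → ℝ, Smooth2 u → ∀ x y : ℝ,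
      r₁ x y * (Dx (Dy u) x y + b x y * Dy u x y + c x y * u x y)
          + opX r (fun x y => a₁₀ x y * Dx u x y + a₀₁ x y * Dy u x y
              + a₀₀ x y * u x y) x y =
        a₁₀ x y * Dx (Dx u) x y + (r₁ x y + a₀₁ x y) * Dx (Dy u) x y
          + (Dx a₁₀ x y + a₀₀ x y + r x y * a₁₀ x y) * Dx u x y
          + (r₁ x y * b x y + Dx a₀₁ x y + r x y * a₀₁ x y) * Dy u x y
          + (r₁ x y * c x y + Dx a₀₀ x y + r x y * a₀₀ x y) * u x y := by
    intro u hu x y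
    rw [opX_firstOrder ha₁₀ ha₀₁ ha₀₀ hu]
    ring
  have dx_zero : ∀ f : ℝ → ℝ → ℝ, (∀ x y, f x y = 0) → ∀ x y, Dx f x y = 0 := by
    intro f hf x y
    simp [Dx, hf]
  constructor
  · intro H
    have K := fun x y => coeffs_eq_zero fun u hu => (expand u hu x y).symm.trans (H u hu x y)
    have h₁₀ : ∀ x y, a₁₀ x y = 0 := fun x y => (K x y).1
    have h₀₀ : ∀ x y, a₀₀ x y = 0 := fun x y => by
      simpa [dx_zero _ h₁₀, h₁₀] using (K x y).2.2.1
    have hr₁₀ : ∀ x y, r₁ x y = -a₀₁ x y := fun x y => by linarith [(K x y).2.1]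
    refine ⟨h₁₀, h₀₀, hr₁₀, fun x y => ?_, fun x y => ?_⟩
    · have := (K x y).2.2.2.1
      rw [hr₁₀] at this
      linarith
    · have := (K x y).2.2.2.2
      rw [hr₁₀, h₀₀, dx_zero _ h₀₀] at this
      linarith
  · rintro ⟨h₁₀, h₀₀, hr₁₀, hdx, hc₀⟩ u hu x y
    rw [expand u hu, dx_zero _ h₁₀, dx_zero _ h₀₀, h₁₀, h₀₀, hr₁₀, hdx]
    linear_combination -u x y * hc₀ x y
end

section
/- Let α, β ∈ ℝ with α ≠ 0 and β ≠ 0, and set w(x,y) = y + αx + β. Then for every smooth u : ℝ² → ℝ and every point with w ≠ 0, applying the operator M₂ : u ↦ ∂ₓ∂_yu − (1/w)·∂ₓu − (α/w)·∂_yu followed by M₁ : v ↦ ∂ₓ∂_yv + (1/w)·∂ₓv + (α/w)·∂_yv yields M₁(M₂(u)) = ∂ₓ∂ₓ∂_y∂_yu. That is, D_{xxyy} admits the family of factorizations of type (XY)(XY): D_{xxyy} = (D_{xy} + (1/w)Dₓ + (α/w)D_y)∘(D_{xy} − (1/w)Dₓ − (α/w)D_y). -/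
namespace Smooth2

variable {u : ℝ → ℝ → ℝ}

theorem hasDerivAt_fst_fderiv (hu : Smooth2 u) (x y : ℝ) :
    HasDerivAt (fun s => u s y) (fderiv ℝ (fun p : ℝ × ℝ => u p.1 p.2) (x, y) (1, 0)) x :=
  (hu.differentiable (by simp) (x, y)).hasFDerivAt.comp_hasDerivAt (f := fun s => (s, y)) x
    ((hasDerivAt_id x).prodMk (hasDerivAt_const x y))

theorem hasDerivAt_snd_fderiv (hu : Smooth2 u) (x y : ℝ) :
    HasDerivAt (fun t => u x t) (fderiv ℝ (fun p : ℝ × ℝ => u p.1 p.2) (x, y) (0, 1)) y :=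
  (hu.differentiable (by simp) (x, y)).hasFDerivAt.comp_hasDerivAt y
    ((hasDerivAt_const y x).prodMk (hasDerivAt_id y))

theorem Dx_eq_fderiv (hu : Smooth2 u) (x y : ℝ) :
    _root_.Dx u x y = fderiv ℝ (fun p : ℝ × ℝ => u p.1 p.2) (x, y) (1, 0) :=
  (hu.hasDerivAt_fst_fderiv x y).deriv

theorem Dy_eq_fderiv (hu : Smooth2 u) (x y : ℝ) :
    _root_.Dy u x y = fderiv ℝ (fun p : ℝ × ℝ => u p.1 p.2) (x, y) (0, 1) :=
  (hu.hasDerivAt_snd_fderiv x y).deriv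

theorem hasDerivAt_fst (hu : Smooth2 u) (x y : ℝ) :
    HasDerivAt (fun s => u s y) (_root_.Dx u x y) x :=
  (hu.hasDerivAt_fst_fderiv x y).differentiableAt.hasDerivAt

theorem hasDerivAt_snd (hu : Smooth2 u) (x y : ℝ) :
    HasDerivAt (fun t => u x t) (_root_.Dy u x y) y :=
  (hu.hasDerivAt_snd_fderiv x y).differentiableAt.hasDerivAt

theorem contDiff_fderiv (hu : Smooth2 u) :
    ContDiff ℝ (⊤ : ℕ∞) (fderiv ℝ (fun p : ℝ × ℝ => u p.1 p.2)) :=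
  ContDiff.fderiv_right hu (by simp)

theorem Dx (hu : Smooth2 u) : Smooth2 (Dx u) := by
  simp only [Smooth2, hu.Dx_eq_fderiv]
  exact hu.contDiff_fderiv.clm_apply contDiff_const

theorem Dy (hu : Smooth2 u) : Smooth2 (Dy u) := by
  simp only [Smooth2, hu.Dy_eq_fderiv]
  exact hu.contDiff_fderiv.clm_apply contDiff_const

/-- Mixed partial derivatives of a smooth function commute. -/
theorem Dx_Dy_comm (hu : Smooth2 u) : _root_.Dx (_root_.Dy u) = _root_.Dy (_root_.Dx u) := by
  ext x y
  have hd : DifferentiableAt ℝ (fderiv ℝ (fun p : ℝ × ℝ => u p.1 p.2)) (x, y) :=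
    hu.contDiff_fderiv.differentiable (by simp) (x, y)
  have hsymm : IsSymmSndFDerivAt ℝ (fun p : ℝ × ℝ => u p.1 p.2) (x, y) :=
    (ContDiff.contDiffAt hu).isSymmSndFDerivAt (by
      simpa using WithTop.coe_le_coe.2 (le_top : (2 : ℕ∞) ≤ ⊤))
  rw [hu.Dy.Dx_eq_fderiv, hu.Dx.Dy_eq_fderiv]
  simp only [hu.Dx_eq_fderiv, hu.Dy_eq_fderiv]
  rw [fderiv_clm_apply hd (differentiableAt_const _),
    fderiv_clm_apply hd (differentiableAt_const _)]
  simpa using hsymm.eq (1, 0) (0, 1)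

end Smooth2

theorem hasDerivAt_div_affine_fst (α β c : ℝ) {x y : ℝ} (hw : y + α * x + β ≠ 0) :
    HasDerivAt (fun s => c / (y + α * s + β)) (-(c * α) / (y + α * x + β) ^ 2) x := by
  have h : HasDerivAt (fun s => y + α * s + β) α x := by
    simpa using (((hasDerivAt_id x).const_mul α).const_add y).add_const β
  simpa using (hasDerivAt_const x c).fun_div h hw

theorem hasDerivAt_div_affine_snd (α β c : ℝ) {x y : ℝ} (hw : y + α * x + β ≠ 0) :
    HasDerivAt (fun t => c / (t + α * x + β)) (-c / (y + α * x + β) ^ 2) y := by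
  have h : HasDerivAt (fun t => t + α * x + β) 1 y :=
    ((hasDerivAt_id y).add_const (α * x)).add_const β
  simpa using (hasDerivAt_const y c).fun_div h hw

theorem hasDerivAt_div_affine_sq_fst (α β c : ℝ) {x y : ℝ} (hw : y + α * x + β ≠ 0) :
    HasDerivAt (fun s => c / (y + α * s + β) ^ 2) (-(2 * c * α) / (y + α * x + β) ^ 3) x := by
  have h : HasDerivAt (fun s => y + α * s + β) α x := by
    simpa using (((hasDerivAt_id x).const_mul α).const_add y).add_const β
  refine ((hasDerivAt_const x c).fun_div (h.fun_pow 2) (pow_ne_zero 2 hw)).congr_deriv ?_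
  field_simp
  ring

theorem stmt16 (α β : ℝ) (hα : α ≠ 0) (hβ : β ≠ 0) :
    ∀ u : ℝ → ℝ → ℝ, Smooth2 u → ∀ x y : ℝ, y + α * x + β ≠ 0 →
      (fun v : ℝ → ℝ → ℝ => fun x y => Dx (Dy v) x y
          + (1 / (y + α * x + β)) * Dx v x y
          + (α / (y + α * x + β)) * Dy v x y)
        (fun x y => Dx (Dy u) x y
          - (1 / (y + α * x + β)) * Dx u x y
          - (α / (y + α * x + β)) * Dy u x y) x y
        = Dx (Dx (Dy (Dy u))) x y := by
  intro u hu x y hw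
  have huy := hu.Dy
  have hux := hu.Dx
  have huxy := huy.Dx
  have huyy := huy.Dy
  have hv_y : ∀ x y : ℝ, y + α * x + β ≠ 0 →
      HasDerivAt (fun t => Dx (Dy u) x t - (1 / (t + α * x + β)) * Dx u x t
          - (α / (t + α * x + β)) * Dy u x t)
        (Dx (Dy (Dy u)) x y
          - (-1 / (y + α * x + β) ^ 2 * Dx u x y + 1 / (y + α * x + β) * Dx (Dy u) x y)
          - (-α / (y + α * x + β) ^ 2 * Dy u x y
            + α / (y + α * x + β) * Dy (Dy u) x y)) y := by
    intro x y hw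
    have h₁ := huxy.hasDerivAt_snd x y
    have h₂ := hux.hasDerivAt_snd x y
    rw [← huy.Dx_Dy_comm] at h₁
    rw [← hu.Dx_Dy_comm] at h₂
    exact (h₁.sub ((hasDerivAt_div_affine_snd α β 1 hw).mul h₂)).sub
      ((hasDerivAt_div_affine_snd α β α hw).mul (huy.hasDerivAt_snd x y))
  have hv_x : HasDerivAt (fun s => Dx (Dy u) s y - (1 / (y + α * s + β)) * Dx u s y
          - (α / (y + α * s + β)) * Dy u s y)
        (Dx (Dx (Dy u)) x y
          - (-(1 * α) / (y + α * x + β) ^ 2 * Dx u x y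
            + 1 / (y + α * x + β) * Dx (Dx u) x y)
          - (-(α * α) / (y + α * x + β) ^ 2 * Dy u x y
            + α / (y + α * x + β) * Dx (Dy u) x y)) x :=
    ((huxy.hasDerivAt_fst x y).sub
      ((hasDerivAt_div_affine_fst α β 1 hw).mul (hux.hasDerivAt_fst x y))).sub
      ((hasDerivAt_div_affine_fst α β α hw).mul (huy.hasDerivAt_fst x y))
  have hv_xy : HasDerivAt (fun s => Dx (Dy (Dy u)) s y
          - (-1 / (y + α * s + β) ^ 2 * Dx u s y + 1 / (y + α * s + β) * Dx (Dy u) s y)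
          - (-α / (y + α * s + β) ^ 2 * Dy u s y
            + α / (y + α * s + β) * Dy (Dy u) s y))
        (Dx (Dx (Dy (Dy u))) x y
          - ((-(2 * -1 * α) / (y + α * x + β) ^ 3 * Dx u x y
              + -1 / (y + α * x + β) ^ 2 * Dx (Dx u) x y)
            + (-(1 * α) / (y + α * x + β) ^ 2 * Dx (Dy u) x y
              + 1 / (y + α * x + β) * Dx (Dx (Dy u)) x y))
          - ((-(2 * -α * α) / (y + α * x + β) ^ 3 * Dy u x y
              + -α / (y + α * x + β) ^ 2 * Dx (Dy u) x y)
            + (-(α * α) / (y + α * x + β) ^ 2 * Dy (Dy u) x y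
              + α / (y + α * x + β) * Dx (Dy (Dy u)) x y))) x :=
    ((huyy.Dx.hasDerivAt_fst x y).sub
      (((hasDerivAt_div_affine_sq_fst α β (-1) hw).mul (hux.hasDerivAt_fst x y)).add
        ((hasDerivAt_div_affine_fst α β 1 hw).mul (huxy.hasDerivAt_fst x y)))).sub
      (((hasDerivAt_div_affine_sq_fst α β (-α) hw).mul (huy.hasDerivAt_fst x y)).add
        ((hasDerivAt_div_affine_fst α β α hw).mul (huyy.hasDerivAt_fst x y)))
  have hw_near : ∀ᶠ s in nhds x, y + α * s + β ≠ 0 :=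
    ContinuousAt.eventually_ne (g := fun s => y + α * s + β) (by fun_prop) hw
  have hv_xy' := (hv_xy.congr_of_eventuallyEq
    (hw_near.mono fun s hs => (hv_y s y hs).deriv)).deriv
  have hv_y' := (hv_y x y hw).deriv
  have hv_x' := hv_x.deriv
  change deriv (fun s => deriv (fun t => Dx (Dy u) s t - (1 / (t + α * s + β)) * Dx u s t
          - (α / (t + α * s + β)) * Dy u s t) y) x
      + (1 / (y + α * x + β)) * deriv (fun s => Dx (Dy u) s y
          - (1 / (y + α * s + β)) * Dx u s y - (α / (y + α * s + β)) * Dy u s y) x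
      + (α / (y + α * x + β)) * deriv (fun t => Dx (Dy u) x t
          - (1 / (t + α * x + β)) * Dx u x t - (α / (t + α * x + β)) * Dy u x t) y = _
  rw [hv_xy', hv_x', hv_y']
  generalize y + α * x + β = w at hw ⊢
  field_simp
  ring
end
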